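/- arXiv:1910.08042 — 2 statements merged into one kernel-verified Lean document; each statement's English description precedes it below -/
import Mathlib

section
/- Non-identification of the adjustment functional from observables: let P be a joint probability distribution on γ × α × ζ for (Y, A, Z) assigning positive probability to every point, and for a joint distribution Q define the adjusted value adj(Q, a, y) = Σ_z Q(Z = z) · Q(Y = y | Z = z, A = a). Fix a ∈ α and y ∈ γ. If adj(P, a, y) ≠ P(Y = y | A = a), then there exists a joint distribution Q on γ × α × ζ whose (Y, A)-marginal equals that of P and whose (A, Z)-marginal equals that of P, but with adj(Q, a, y) ≠ adj(P, a, y); in particular, Q may be taken to be the distribution Q(Y = y', A = a', Z = z') = P(Y = y', A = a') · P(Z = z', A = a') / P(A = a'), for which adj(Q, a, y) = P(Y = y | A = a). -/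
open Finset

/-- `(Y, A)`-marginal of a joint pmf `Q` on `γ × α × ζ`. -/
noncomputable def margYA {γ α ζ : Type*} [Fintype ζ] (Q : γ × α × ζ → ENNReal)
    (y : γ) (a : α) : ENNReal :=
  ∑ z, Q (y, a, z)

/-- `(A, Z)`-marginal of a joint pmf `Q` on `γ × α × ζ`. -/
noncomputable def margAZ {γ α ζ : Type*} [Fintype γ] (Q : γ × α × ζ → ENNReal)
    (a : α) (z : ζ) : ENNReal :=
  ∑ y, Q (y, a, z)

/-- `Z`-marginal of a joint pmf `Q` on `γ × α × ζ`. -/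
noncomputable def margZ {γ α ζ : Type*} [Fintype γ] [Fintype α] (Q : γ × α × ζ → ENNReal)
    (z : ζ) : ENNReal :=
  ∑ y, ∑ a, Q (y, a, z)

/-- `A`-marginal of a joint pmf `Q` on `γ × α × ζ`. -/
noncomputable def margA {γ α ζ : Type*} [Fintype γ] [Fintype ζ] (Q : γ × α × ζ → ENNReal)
    (a : α) : ENNReal :=
  ∑ y, ∑ z, Q (y, a, z)

/-- The discrete adjustment formula applied to a joint pmf `Q`:
`adj(Q, a, y) = Σ_z Q(Z = z) · Q(Y = y | Z = z, A = a)`. -/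
noncomputable def adj {γ α ζ : Type*} [Fintype γ] [Fintype α] [Fintype ζ]
    (Q : γ × α × ζ → ENNReal) (a : α) (y : γ) : ENNReal :=
  ∑ z, margZ Q z * (Q (y, a, z) / margAZ Q a z)

theorem margZ_eq_sum_margAZ {γ α ζ : Type*} [Fintype γ] [Fintype α]
    (Q : γ × α × ζ → ENNReal) (z : ζ) : margZ Q z = ∑ a, margAZ Q a z :=
  Finset.sum_comm

section Marginals

variable {γ α ζ : Type*} [Fintype γ] [Fintype ζ]

theorem sum_margYA (Q : γ × α × ζ → ENNReal) (a : α) : ∑ y, margYA Q y a = margA Q a := rfl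

theorem sum_margAZ (Q : γ × α × ζ → ENNReal) (a : α) : ∑ z, margAZ Q a z = margA Q a :=
  Finset.sum_comm

theorem sum_sum_margAZ [Fintype α] (Q : γ × α × ζ → ENNReal) :
    ∑ z, ∑ a, margAZ Q a z = ∑ p, Q p := by
  simp only [margAZ, Fintype.sum_prod_type]
  rw [Finset.sum_comm]
  simp_rw [Finset.sum_comm (s := (univ : Finset ζ)) (t := (univ : Finset γ))]
  exact Finset.sum_comm

/-- The coupling of the `(Y, A)`- and `(A, Z)`-marginals of `P` under which `Y` and `Z` are
conditionally independent given `A`. -/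
noncomputable def condIndepCoupling (P : γ × α × ζ → ENNReal) : γ × α × ζ → ENNReal :=
  fun p => margYA P p.1 p.2.1 * margAZ P p.2.1 p.2.2 / margA P p.2.1

theorem margYA_condIndepCoupling {P : γ × α × ζ → ENNReal} {a : α}
    (h0 : margA P a ≠ 0) (htop : margA P a ≠ ⊤) (y : γ) :
    margYA (condIndepCoupling P) y a = margYA P y a := by
  change ∑ z, margYA P y a * margAZ P a z / margA P a = _
  simp_rw [mul_div_assoc, ← Finset.mul_sum, div_eq_mul_inv, ← Finset.sum_mul]
  rw [sum_margAZ, ENNReal.mul_inv_cancel h0 htop, mul_one]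

theorem margAZ_condIndepCoupling {P : γ × α × ζ → ENNReal} {a : α}
    (h0 : margA P a ≠ 0) (htop : margA P a ≠ ⊤) (z : ζ) :
    margAZ (condIndepCoupling P) a z = margAZ P a z := by
  change ∑ y, margYA P y a * margAZ P a z / margA P a = _
  simp_rw [div_eq_mul_inv, mul_assoc, ← Finset.sum_mul]
  rw [sum_margYA, mul_left_comm, ENNReal.mul_inv_cancel h0 htop, mul_one]

end Marginals

/-- Non-identification of the adjustment functional from observables: if `P` is a strictly
positive joint pmf on `γ × α × ζ` and `adj(P, a, y) ≠ P(Y = y | A = a)`, then there is a joint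
pmf `Q` with the same `(Y, A)`- and `(A, Z)`-marginals as `P` but `adj(Q, a, y) ≠ adj(P, a, y)`;
in particular `Q(y', a', z') = P(Y = y', A = a') · P(Z = z', A = a') / P(A = a')` works, and for
it `adj(Q, a, y) = P(Y = y | A = a)`. -/
theorem stmt_3 {γ α ζ : Type*} [Fintype γ] [Fintype α] [Fintype ζ]
    (P : γ × α × ζ → ENNReal)
    (hpos : ∀ p, 0 < P p) (hsum : ∑ p, P p = 1)
    (a : α) (y : γ)
    (hne : adj P a y ≠ margYA P y a / margA P a) :
    ∃ Q : γ × α × ζ → ENNReal,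
      (∑ p, Q p = 1) ∧
      (∀ (y' : γ) (a' : α), margYA Q y' a' = margYA P y' a') ∧
      (∀ (a' : α) (z' : ζ), margAZ Q a' z' = margAZ P a' z') ∧
      adj Q a y ≠ adj P a y ∧
      Q = (fun p => margYA P p.1 p.2.1 * margAZ P p.2.1 p.2.2 / margA P p.2.1) ∧
      adj Q a y = margYA P y a / margA P a := by
  have hfin : ∀ p, P p ≠ ⊤ := fun p =>
    ne_top_of_le_ne_top (hsum ▸ ENNReal.one_ne_top)
      (Finset.single_le_sum (fun _ _ => zero_le) (Finset.mem_univ p))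
  have : Nonempty (γ × α × ζ) := by
    by_contra h
    rw [not_nonempty_iff] at h
    simp at hsum
  obtain ⟨-, -, z₀⟩ := this
  have hAZ0 : ∀ a' z, margAZ P a' z ≠ 0 := fun a' z h =>
    (hpos (y, a', z)).ne' (Finset.sum_eq_zero_iff.1 h y (Finset.mem_univ y))
  have hAZtop : ∀ a' z, margAZ P a' z ≠ ⊤ := fun a' z =>
    ENNReal.sum_ne_top.2 fun y' _ => hfin (y', a', z)
  have hA0 : ∀ a', margA P a' ≠ 0 := fun a' h => by
    rw [← sum_margAZ] at h
    exact hAZ0 a' z₀ (Finset.sum_eq_zero_iff.1 h z₀ (Finset.mem_univ z₀))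
  have hAtop : ∀ a', margA P a' ≠ ⊤ := fun a' => by
    rw [← sum_margAZ]
    exact ENNReal.sum_ne_top.2 fun z _ => hAZtop a' z
  have hAZ : ∀ a' z, margAZ (condIndepCoupling P) a' z = margAZ P a' z := fun a' z =>
    margAZ_condIndepCoupling (hA0 a') (hAtop a') z
  have hone : ∑ z, margZ (condIndepCoupling P) z = 1 := by
    simp_rw [margZ_eq_sum_margAZ, hAZ]
    rw [sum_sum_margAZ, hsum]
  have hadj : adj (condIndepCoupling P) a y = margYA P y a / margA P a := by
    have hcond : ∀ z, condIndepCoupling P (y, a, z) / margAZ (condIndepCoupling P) a z =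
        margYA P y a / margA P a := fun z => by
      rw [hAZ]
      change margYA P y a * margAZ P a z / margA P a / margAZ P a z = _
      rw [div_eq_mul_inv, div_eq_mul_inv, mul_right_comm, mul_assoc (margYA P y a),
        ENNReal.mul_inv_cancel (hAZ0 a z) (hAZtop a z), mul_one, div_eq_mul_inv]
    simp_rw [adj, hcond]
    rw [← Finset.sum_mul, hone, one_mul]
  refine ⟨condIndepCoupling P, ?_,
    fun y' a' => margYA_condIndepCoupling (hA0 a') (hAtop a') y', hAZ, ?_, rfl, hadj⟩
  · rw [← sum_sum_margAZ]
    simpa only [margZ_eq_sum_margAZ] using hone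
  · rw [hadj]
    exact hne.symm
end

section
/- Identification of counterfactual distributions within confounder level sets (equation (8)): suppose the latent confounder is a deterministic function of the causes, Z = ẑ ∘ A for some function ẑ : α → ζ, SUTVA holds (Y_obs(ω) = Y(A(ω))(ω)), and unconfoundedness given Z holds (for each a, Y(a) is conditionally independent of A given Z). Then for any pair of cause values a, a' ∈ α with ẑ(a) = ẑ(a'), P(A = a) > 0, and P(A = a') > 0, and any outcome value y, the counterfactual distribution satisfies P(Y(a') = y | A = a) = P(Y_obs = y | A = a'). -/
open MeasureTheory Finset

/-- Conditional probability `P(E | F) = P(E ∩ F) / P(F)`. -/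
noncomputable def condProb {Ω : Type*} [MeasurableSpace Ω] (P : Measure Ω) (E F : Set Ω) :
    ENNReal :=
  P (E ∩ F) / P F

/-- If `E` and `F` are conditionally independent given `G` and `F ⊆ G`, then conditioning `E` on `F`
is the same as conditioning it on `G`. -/
theorem condProb_eq_of_subset {Ω : Type*} [MeasurableSpace Ω] (P : Measure Ω) [IsFiniteMeasure P]
    {E F G : Set Ω} (hFG : F ⊆ G) (hF : P F ≠ 0)
    (h : condProb P (E ∩ F) G = condProb P E G * condProb P F G) :
    condProb P E F = condProb P E G := by
  have hG : P G ≠ 0 := fun h0 => hF (measure_mono_null hFG h0)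
  have hmul : P (E ∩ F) = condProb P E G * P F := by
    have h' : P (E ∩ F) / P G = condProb P E G * P F / P G := by
      rw [mul_div_assoc]
      simpa only [condProb, Set.inter_assoc, Set.inter_eq_left.2 hFG] using h
    rw [← ENNReal.div_mul_cancel hG (measure_ne_top P G) (b := P (E ∩ F)), h',
      ENNReal.div_mul_cancel hG (measure_ne_top P G)]
  rw [condProb, hmul, ENNReal.mul_div_cancel_right hF (measure_ne_top P F)]

/-- Identification of counterfactual distributions within confounder level sets: if the latent
confounder is a deterministic function of the causes, `Z = ẑ ∘ A`, SUTVA holds, and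
unconfoundedness given `Z` holds, then for any `a, a'` with `ẑ(a) = ẑ(a')`, `P(A = a) > 0`, and
`P(A = a') > 0`, and any `y`, `P(Y(a') = y | A = a) = P(Y_obs = y | A = a')`. -/
theorem stmt_6 {Ω α γ ζ : Type*} [MeasurableSpace Ω] [Fintype α] [Fintype γ] [Fintype ζ]
    (P : Measure Ω) [IsProbabilityMeasure P]
    (A : Ω → α) (Yobs : Ω → γ) (Z : Ω → ζ) (Y : α → Ω → γ)
    (zhat : α → ζ)
    (hdet : ∀ ω, Z ω = zhat (A ω))
    (sutva : ∀ ω, Yobs ω = Y (A ω) ω)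
    (unconf : ∀ (a : α) (y : γ) (a'' : α) (z : ζ), 0 < P {ω | Z ω = z} →
      condProb P {ω | Y a ω = y ∧ A ω = a''} {ω | Z ω = z} =
        condProb P {ω | Y a ω = y} {ω | Z ω = z} * condProb P {ω | A ω = a''} {ω | Z ω = z}) :
    ∀ (a a' : α), zhat a = zhat a' → 0 < P {ω | A ω = a} → 0 < P {ω | A ω = a'} →
      ∀ y : γ,
        condProb P {ω | Y a' ω = y} {ω | A ω = a} =
          condProb P {ω | Yobs ω = y} {ω | A ω = a'} := by
  intro a a' haa' ha ha' y
  have sub : ∀ b, {ω | A ω = b} ⊆ {ω | Z ω = zhat b} := by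
    rintro b ω rfl
    exact hdet ω
  have key : ∀ b, 0 < P {ω | A ω = b} →
      condProb P {ω | Y a' ω = y} {ω | A ω = b} =
        condProb P {ω | Y a' ω = y} {ω | Z ω = zhat b} := fun b hb =>
    condProb_eq_of_subset P (sub b) hb.ne'
      (unconf a' y b (zhat b) (hb.trans_le (measure_mono (sub b))))
  have hobs : {ω | Yobs ω = y} ∩ {ω | A ω = a'} = {ω | Y a' ω = y} ∩ {ω | A ω = a'} := by
    ext ω
    simp only [Set.mem_inter_iff, Set.mem_ofPred_eq, and_congr_left_iff]
    rintro rfl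
    rw [sutva]
  calc condProb P {ω | Y a' ω = y} {ω | A ω = a}
      = condProb P {ω | Y a' ω = y} {ω | A ω = a'} := by rw [key a ha, key a' ha', haa']
    _ = condProb P {ω | Yobs ω = y} {ω | A ω = a'} := by rw [condProb, condProb, hobs]
end
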